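/- arXiv:1007.5508 — 2 statements merged into one kernel-verified Lean document; each statement's English description precedes it below -/
import Mathlib

section
/- The product of ℤ-submodules I_f·I_f^# inside Q_f equals the ℤ-submodule of Q_f spanned by the elements f_0·1, f_1·1, …, f_n·1 together with ζ_1, ζ_2, …, ζ_{n−1}. -/
open Polynomial

noncomputable section

/-- The polynomial `f₀ Tⁿ + f₁ Tⁿ⁻¹ + ⋯ + fₙ` over `ℚ`. -/
def fpoly (n : ℕ) (f : ℕ → ℤ) : Polynomial ℚ :=
  ∑ i ∈ Finset.range (n + 1), Polynomial.C (f i : ℚ) * Polynomial.X ^ (n - i)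

/-- `Q_f = ℚ[T]/(f₀ Tⁿ + ⋯ + fₙ)`. -/
abbrev Qf (n : ℕ) (f : ℕ → ℤ) := AdjoinRoot (fpoly n f)

/-- `θ`, the image of `T` in `Q_f`. -/
def th (n : ℕ) (f : ℕ → ℤ) : Qf n f := AdjoinRoot.root _

/-- `ζ₀ = 1`, and `ζ_k = f₀ θ^k + f₁ θ^(k-1) + ⋯ + f_(k-1) θ` for `k ≥ 1`. -/
def zeta (n : ℕ) (f : ℕ → ℤ) (k : ℕ) : Qf n f :=
  if k = 0 then 1 else ∑ i ∈ Finset.range k, (f i : Qf n f) * th n f ^ (k - i)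

/-- `R_f`, the ℤ-span of `ζ₀, …, ζ_(n-1)` in `Q_f`. -/
def Rf (n : ℕ) (f : ℕ → ℤ) : Submodule ℤ (Qf n f) :=
  Submodule.span ℤ (Set.range fun k : Fin n => zeta n f k)

/-- `I_f`, the `R_f`-submodule of `Q_f` generated by `1` and `θ`,
as a ℤ-submodule of `Q_f`. -/
def If (n : ℕ) (f : ℕ → ℤ) : Submodule ℤ (Qf n f) :=
  Rf n f * Submodule.span ℤ {1, th n f}

/-- `I_f^#`, the ℤ-span of `f₀, f₀θ + f₁, …, f₀θ^(n-1) + f₁θ^(n-2) + ⋯ + f_(n-1)`. -/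
def Ish (n : ℕ) (f : ℕ → ℤ) : Submodule ℤ (Qf n f) :=
  Submodule.span ℤ (Set.range fun j : Fin n =>
    ∑ i ∈ Finset.range ((j : ℕ) + 1), (f i : Qf n f) * th n f ^ ((j : ℕ) - i))

/-- The truncation `f₀ θ^j + f₁ θ^(j-1) + ⋯ + f_j`. -/
def hornerTrunc (n : ℕ) (f : ℕ → ℤ) (j : ℕ) : Qf n f :=
  ∑ i ∈ Finset.range (j + 1), (f i : Qf n f) * th n f ^ (j - i)

theorem hornerTrunc_zero (n : ℕ) (f : ℕ → ℤ) : hornerTrunc n f 0 = (f 0 : Qf n f) := by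
  simp [hornerTrunc]

theorem zeta_succ (n : ℕ) (f : ℕ → ℤ) (k : ℕ) :
    zeta n f (k + 1) = th n f * hornerTrunc n f k := by
  rw [zeta, if_neg k.succ_ne_zero, hornerTrunc, Finset.mul_sum]
  refine Finset.sum_congr rfl fun i hi => ?_
  rw [Nat.sub_add_comm (Finset.mem_range_succ_iff.mp hi), pow_succ]
  ring

theorem hornerTrunc_succ_eq_zeta_add (n : ℕ) (f : ℕ → ℤ) (k : ℕ) :
    hornerTrunc n f (k + 1) = zeta n f (k + 1) + (f (k + 1) : Qf n f) := by
  rw [zeta, if_neg k.succ_ne_zero, hornerTrunc, Finset.sum_range_succ]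
  simp

theorem hornerTrunc_succ (n : ℕ) (f : ℕ → ℤ) (k : ℕ) :
    hornerTrunc n f (k + 1) = th n f * hornerTrunc n f k + (f (k + 1) : Qf n f) := by
  rw [hornerTrunc_succ_eq_zeta_add, zeta_succ]

theorem hornerTrunc_self (n : ℕ) (f : ℕ → ℤ) : hornerTrunc n f n = 0 := by
  have h : AdjoinRoot.mk (fpoly n f) (fpoly n f) = 0 := AdjoinRoot.mk_self
  conv_lhs at h => arg 2; rw [fpoly]
  simpa [hornerTrunc, th] using h

theorem intCast_mul_mem {A : Type*} [Ring A] (M : Submodule ℤ A) (c : ℤ) {x : A} (hx : x ∈ M) :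
    (c : A) * x ∈ M := by
  simpa using M.smul_mem c hx

theorem hornerTrunc_mem_Ish {n : ℕ} {f : ℕ → ℤ} {j : ℕ} (hj : j ≤ n) :
    hornerTrunc n f j ∈ Ish n f := by
  rcases hj.eq_or_lt with rfl | hj
  · simp [hornerTrunc_self]
  · exact Submodule.subset_span ⟨⟨j, hj⟩, rfl⟩

theorem hornerTrunc_mul_mem_Ish {n : ℕ} {f : ℕ → ℤ} {k j : ℕ} (hk : k ≤ n) (hj : j ≤ n) :
    hornerTrunc n f k * hornerTrunc n f j ∈ Ish n f := by
  induction k generalizing j with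
  | zero =>
    rw [hornerTrunc_zero]
    exact intCast_mul_mem _ _ (hornerTrunc_mem_Ish hj)
  | succ k ih =>
    rcases hj.eq_or_lt with rfl | hj
    · simp [hornerTrunc_self]
    · have h : hornerTrunc n f (k + 1) * hornerTrunc n f j =
          hornerTrunc n f k * hornerTrunc n f (j + 1) + (f (k + 1) : Qf n f) * hornerTrunc n f j
            - (f (j + 1) : Qf n f) * hornerTrunc n f k := by
        rw [hornerTrunc_succ, hornerTrunc_succ]
        ring
      rw [h]
      exact sub_mem (add_mem (ih (by omega) hj)
        (intCast_mul_mem _ _ (hornerTrunc_mem_Ish hj.le)))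
        (intCast_mul_mem _ _ (hornerTrunc_mem_Ish (by omega)))

theorem Rf_mul_Ish {n : ℕ} (hn : 0 < n) (f : ℕ → ℤ) : Rf n f * Ish n f = Ish n f := by
  apply le_antisymm
  · conv_lhs => rw [Rf, Ish, Submodule.span_mul_span]
    rw [Submodule.span_le]
    rintro _ ⟨_, ⟨⟨k, hk⟩, rfl⟩, _, ⟨⟨j, hj⟩, rfl⟩, rfl⟩
    change zeta n f k * hornerTrunc n f j ∈ Ish n f
    cases k with
    | zero => simpa [zeta] using hornerTrunc_mem_Ish hj.le
    | succ k =>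
      rw [eq_sub_of_add_eq (hornerTrunc_succ_eq_zeta_add n f k).symm, sub_mul]
      exact sub_mem (hornerTrunc_mul_mem_Ish hk.le hj.le)
        (intCast_mul_mem _ _ (hornerTrunc_mem_Ish hj.le))
  · intro x hx
    have h_one : (1 : Qf n f) ∈ Rf n f := Submodule.subset_span ⟨⟨0, hn⟩, by simp [zeta]⟩
    simpa using Submodule.mul_mem_mul h_one hx

theorem span_one_th_mul_Ish {n : ℕ} (hn : 0 < n) (f : ℕ → ℤ) :
    Submodule.span ℤ {1, th n f} * Ish n f =
      Submodule.span ℤ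
        (((fun i : ℕ => ((f i : ℤ) : Qf n f)) '' Set.Iic n) ∪
          ((fun k : ℕ => zeta n f k) '' Set.Icc 1 (n - 1))) := by
  apply le_antisymm
  · rw [Ish, Submodule.span_mul_span, Submodule.span_le]
    have hf {i : ℕ} (hi : i ≤ n) := Submodule.subset_span (R := ℤ)
      (Set.mem_union_left ((fun k : ℕ => zeta n f k) '' Set.Icc 1 (n - 1))
        (Set.mem_image_of_mem (fun i : ℕ => ((f i : ℤ) : Qf n f)) (Set.mem_Iic.mpr hi)))
    have hz {k : ℕ} (hk : k + 1 < n) := Submodule.subset_span (R := ℤ)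
      (Set.mem_union_right ((fun i : ℕ => ((f i : ℤ) : Qf n f)) '' Set.Iic n)
        (Set.mem_image_of_mem (fun k : ℕ => zeta n f k)
          (show k + 1 ∈ Set.Icc 1 (n - 1) from ⟨by omega, by omega⟩)))
    rintro _ ⟨_, rfl | rfl, _, ⟨⟨j, hj⟩, rfl⟩, rfl⟩
    · change 1 * hornerTrunc n f j ∈ Submodule.span ℤ _
      rw [one_mul]
      cases j with
      | zero => rw [hornerTrunc_zero]; exact hf hj.le
      | succ j => rw [hornerTrunc_succ_eq_zeta_add]; exact add_mem (hz hj) (hf hj.le)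
    · change th n f * hornerTrunc n f j ∈ Submodule.span ℤ _
      rcases (Nat.succ_le_of_lt hj).eq_or_lt with rfl | hj'
      · have h := hornerTrunc_succ (j + 1) f j
        rw [hornerTrunc_self] at h
        rw [eq_neg_of_add_eq_zero_left h.symm]
        exact neg_mem (hf le_rfl)
      · rw [← zeta_succ]
        exact hz hj'
  · have h_one {j : ℕ} (hj : j ≤ n) :
        hornerTrunc n f j ∈ Submodule.span ℤ {1, th n f} * Ish n f := by
      simpa using Submodule.mul_mem_mul
        (Submodule.subset_span (R := ℤ) (Set.mem_insert 1 {th n f})) (hornerTrunc_mem_Ish hj)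
    have h_zeta {k : ℕ} (hk : k ≤ n) :
        zeta n f (k + 1) ∈ Submodule.span ℤ {1, th n f} * Ish n f := by
      rw [zeta_succ]
      exact Submodule.mul_mem_mul (Submodule.subset_span (by simp)) (hornerTrunc_mem_Ish hk)
    rw [Submodule.span_le]
    rintro _ (⟨i, hi, rfl⟩ | ⟨k, ⟨hk, hkn⟩, rfl⟩)
    · rw [Set.mem_Iic] at hi
      cases i with
      | zero => simpa [hornerTrunc_zero] using h_one hi
      | succ i =>
        have h := sub_mem (h_one hi) (h_zeta (k := i) (by omega))
        rwa [hornerTrunc_succ_eq_zeta_add, add_sub_cancel_left] at h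
    · obtain ⟨k, rfl⟩ := Nat.exists_eq_add_of_le' hk
      exact h_zeta (by omega)

/-- `I_f · I_f^#` is the ℤ-span of `f₀·1, f₁·1, …, f_n·1` together with
`ζ₁, ζ₂, …, ζ_(n-1)`. -/
theorem stmt6 (n : ℕ) (hn : 2 ≤ n) (f : ℕ → ℤ) (hf0 : f 0 ≠ 0) :
    If n f * Ish n f =
      Submodule.span ℤ
        (((fun i : ℕ => ((f i : ℤ) : Qf n f)) '' Set.Iic n) ∪
          ((fun k : ℕ => zeta n f k) '' Set.Icc 1 (n - 1))) := by
  rw [If, mul_right_comm, Rf_mul_Ish (by omega), mul_comm, span_one_th_mul_Ish (by omega)]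

end
end

section
/- There exists an R_f-submodule J of Q_f with I_f·J = R_f (i.e., the fractional ideal I_f is invertible) if and only if gcd(f_0, f_1, …, f_n) = 1 (i.e., the form f is primitive). -/
open Polynomial

noncomputable section

/-- `f₀ θ^k + f₁ θ^(k-1) + ⋯ + f_(k-1) θ`, with value `0` at `k = 0`. -/
def zetaSum (n : ℕ) (f : ℕ → ℤ) (k : ℕ) : Qf n f :=
  ∑ i ∈ Finset.range k, (f i : Qf n f) * th n f ^ (k - i)

section

variable (n : ℕ) (f : ℕ → ℤ)

lemma zetaSum_zero : zetaSum n f 0 = 0 := by simp [zetaSum]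

lemma zetaSum_succ (k : ℕ) :
    zetaSum n f (k + 1) = th n f * (zetaSum n f k + (f k : Qf n f)) := by
  rw [zetaSum, Finset.sum_range_succ, zetaSum, mul_add, Finset.mul_sum]
  congr 1
  · refine Finset.sum_congr rfl fun i hi => ?_
    have : k + 1 - i = (k - i) + 1 := by have := Finset.mem_range.mp hi; omega
    rw [this, pow_succ]; ring
  · simp [mul_comm]

lemma zetaSum_self : zetaSum n f n = -(f n : Qf n f) := by
  have h : AdjoinRoot.mk (fpoly n f) (∑ i ∈ Finset.range (n + 1), C (f i : ℚ) * X ^ (n - i)) = 0 :=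
    AdjoinRoot.mk_self
  rw [map_sum, Finset.sum_range_succ] at h
  simp only [map_mul, map_pow, AdjoinRoot.mk_X, map_intCast, Nat.sub_self, pow_zero,
    mul_one] at h
  exact eq_neg_of_add_eq_zero_left h

lemma zeta_of_ne_zero {k : ℕ} (hk : k ≠ 0) : zeta n f k = zetaSum n f k := by
  rw [zeta, if_neg hk, zetaSum]

lemma natDegree_fpoly (hf0 : f 0 ≠ 0) : (fpoly n f).natDegree = n := by
  refine le_antisymm ?_ (le_natDegree_of_ne_zero ?_)
  · refine natDegree_sum_le_of_forall_le _ _ fun i _ => ?_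
    exact (natDegree_C_mul_X_pow_le _ _).trans (Nat.sub_le _ _)
  · rw [fpoly, finsetSum_coeff, Finset.sum_eq_single 0]
    · simpa using hf0
    · intro i hi hi0
      have := Finset.mem_range.mp hi
      rw [coeff_C_mul_X_pow, if_neg (by omega)]
    · simp

variable {n}

lemma one_mem_Rf (hn : 0 < n) : (1 : Qf n f) ∈ Rf n f :=
  Submodule.subset_span ⟨⟨0, hn⟩, by simp [zeta]⟩

lemma intCast_mem_Rf (hn : 0 < n) (m : ℤ) : (m : Qf n f) ∈ Rf n f := by
  simpa using (Rf n f).smul_mem m (one_mem_Rf f hn)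

lemma zetaSum_mem_Rf (hn : 0 < n) {k : ℕ} (hk : k ≤ n) : zetaSum n f k ∈ Rf n f := by
  rcases Nat.eq_zero_or_pos k with rfl | hk0
  · simp [zetaSum_zero]
  rcases hk.eq_or_lt with rfl | hk
  · rw [zetaSum_self]
    exact neg_mem (intCast_mem_Rf f hn _)
  · rw [← zeta_of_ne_zero n f hk0.ne']
    exact Submodule.subset_span ⟨⟨k, hk⟩, rfl⟩

lemma intCast_mul_mem_s8 {S : Submodule ℤ (Qf n f)} (m : ℤ) {x : Qf n f} (hx : x ∈ S) :
    (m : Qf n f) * x ∈ S := by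
  simpa [zsmul_eq_mul] using S.smul_mem m hx

lemma zetaSum_mul_zetaSum_mem_Rf (hn : 0 < n) {i : ℕ} (hi : i ≤ n) :
    ∀ {j : ℕ}, j ≤ n → zetaSum n f i * zetaSum n f j ∈ Rf n f := by
  induction i with
  | zero => intro j _; simp [zetaSum_zero]
  | succ i ih =>
    intro j hj
    rcases hj.eq_or_lt with rfl | hj
    · rw [zetaSum_self, mul_comm, neg_mul]
      exact neg_mem (intCast_mul_mem_s8 f _ (zetaSum_mem_Rf f hn hi))
    have key : zetaSum n f (i + 1) * zetaSum n f j = zetaSum n f i * zetaSum n f (j + 1)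
        + (f i : Qf n f) * zetaSum n f (j + 1) - (f j : Qf n f) * zetaSum n f (i + 1) := by
      rw [zetaSum_succ, zetaSum_succ]; ring
    rw [key]
    exact sub_mem (add_mem (ih (by omega) hj)
      (intCast_mul_mem_s8 f _ (zetaSum_mem_Rf f hn hj)))
      (intCast_mul_mem_s8 f _ (zetaSum_mem_Rf f hn hi))

lemma Rf_mul_Rf_le (hn : 0 < n) : Rf n f * Rf n f ≤ Rf n f := by
  conv_lhs => rw [Rf, Submodule.span_mul_span]
  rw [Submodule.span_le]
  rintro _ ⟨_, ⟨i, rfl⟩, _, ⟨j, rfl⟩, rfl⟩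
  change zeta n f i * zeta n f j ∈ Rf n f
  have hmem (k : Fin n) : zeta n f k ∈ Rf n f := Submodule.subset_span ⟨k, rfl⟩
  by_cases hi : (i : ℕ) = 0
  · simpa [hi, zeta] using hmem j
  by_cases hj : (j : ℕ) = 0
  · simpa [hj, zeta] using hmem i
  rw [zeta_of_ne_zero n f hi, zeta_of_ne_zero n f hj]
  exact zetaSum_mul_zetaSum_mem_Rf f hn i.2.le j.2.le

/-- The coefficient of `θ^i` in the power basis of `Q_f`. -/
lemma exists_coeff (hf0 : f 0 ≠ 0) {i : ℕ} (hi : i < n) :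
    ∃ c : Qf n f →ₗ[ℤ] ℚ, ∀ j < n, c (th n f ^ j) = if j = i then 1 else 0 := by
  have hdeg := natDegree_fpoly n f hf0
  have hne : fpoly n f ≠ 0 := by
    intro h; rw [h, natDegree_zero] at hdeg; omega
  let b := (AdjoinRoot.powerBasis hne).basis
  have hdim : (AdjoinRoot.powerBasis hne).dim = n := by simp [hdeg]
  refine ⟨(b.coord ⟨i, by omega⟩).restrictScalars ℤ, fun j hj => ?_⟩
  have hb : th n f ^ j = b ⟨j, by omega⟩ := by simp [b, th]
  rw [hb]
  simp [Finsupp.single_apply]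

variable {f}

lemma coeff_zetaSum {c : Qf n f →ₗ[ℤ] ℚ} {i : ℕ}
    (hc : ∀ j < n, c (th n f ^ j) = if j = i then 1 else 0) {k : ℕ} (hk : k < n) :
    c (zetaSum n f k) = if 0 < i ∧ i ≤ k then (f (k - i) : ℚ) else 0 := by
  have h (l : ℕ) (hl : l ∈ Finset.range k) :
      c ((f l : Qf n f) * th n f ^ (k - l)) = if k - l = i then (f l : ℚ) else 0 := by
    rw [← zsmul_eq_mul, map_zsmul, hc _ (by omega)]
    simp
  rw [zetaSum, map_sum, Finset.sum_congr rfl h]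
  split_ifs with hik
  · rw [Finset.sum_eq_single (k - i)]
    · rw [if_pos (by omega)]
    · intro l hl hne
      have := Finset.mem_range.mp hl
      rw [if_neg (by omega)]
    · intro hl
      exact absurd (Finset.mem_range.mpr (by omega)) hl
  · refine Finset.sum_eq_zero fun l hl => ?_
    have := Finset.mem_range.mp hl
    rw [if_neg (by omega)]

lemma isUnit_of_span_mul_eq (hn : 2 ≤ n) (hf0 : f 0 ≠ 0) {d : ℤ} (hd : ∀ i ≤ n, d ∣ f i)
    {J : Submodule ℤ (Qf n f)} (hJ : Submodule.span ℤ {1, th n f} * J = Rf n f) :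
    IsUnit d := by
  obtain ⟨c₀, h₀⟩ := exists_coeff f hf0 (show 0 < n by omega)
  obtain ⟨c₁, h₁⟩ := exists_coeff f hf0 (show 1 < n by omega)
  let D : Submodule ℤ ℚ := Submodule.span ℤ {(d : ℚ)}
  have hD (i : ℕ) (hi : i ≤ n) : (f i : ℚ) ∈ D := by
    obtain ⟨e, he⟩ := hd i hi
    exact Submodule.mem_span_singleton.mpr ⟨e, by rw [he]; push_cast; simp [mul_comm]⟩
  have hint (c : Qf n f →ₗ[ℤ] ℚ) (m : ℤ) : c (m : Qf n f) = m * c 1 := by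
    rw [← mul_one (m : Qf n f), ← zsmul_eq_mul, map_zsmul, zsmul_eq_mul]
  have hmul (c : Qf n f →ₗ[ℤ] ℚ) (m : ℤ) (x : Qf n f) : c (m * x) = m * c x := by
    rw [← zsmul_eq_mul, map_zsmul, zsmul_eq_mul]
  have h01 : c₀ 1 = 1 := by simpa using h₀ 0 (by omega)
  have h0t : c₀ (th n f) = 0 := by simpa using h₀ 1 (by omega)
  have h11 : c₁ 1 = 0 := by simpa using h₁ 0 (by omega)
  have h1t : c₁ (th n f) = 1 := by simpa using h₁ 1 (by omega)
  have hth (k : ℕ) : th n f * zetaSum n f k = zetaSum n f (k + 1) - f k * th n f := by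
    rw [zetaSum_succ]; ring
  have hspan (L : Qf n f →ₗ[ℤ] ℚ) (hL1 : L 1 ∈ D)
      (hL : ∀ k, 0 < k → k < n → L (zetaSum n f k) ∈ D) : ∀ x ∈ Rf n f, L x ∈ D := by
    intro x hx
    suffices h : Rf n f ≤ D.comap L from h hx
    rw [Rf, Submodule.span_le]
    rintro _ ⟨k, rfl⟩
    by_cases hk : (k : ℕ) = 0
    · simpa [hk, zeta] using hL1
    · simpa [zeta_of_ne_zero n f hk] using hL k (by omega) k.2
  have coeff_one_mem : ∀ x ∈ Rf n f, c₁ x ∈ D := by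
    refine hspan c₁ (by simp [h11]) fun k hk hkn => ?_
    rw [coeff_zetaSum h₁ hkn, if_pos ⟨one_pos, hk⟩]
    exact hD _ (by omega)
  have coeff_one_th_mul : ∀ x ∈ Rf n f, c₁ (th n f * x) - c₀ x ∈ D := by
    refine hspan (c₁ ∘ₗ LinearMap.mulLeft ℤ (th n f) - c₀) (by simp [h01, h1t])
      fun k hk hkn => ?_
    simp only [LinearMap.sub_apply, LinearMap.comp_apply, LinearMap.mulLeft_apply]
    rw [coeff_zetaSum h₀ hkn, if_neg (by omega), sub_zero, hth, map_sub, hmul, h1t, mul_one]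
    refine sub_mem ?_ (hD _ hkn.le)
    rcases (show k + 1 ≤ n from hkn).eq_or_lt with h | h
    · rw [h, zetaSum_self, map_neg, hint, h11]
      simp
    · rw [coeff_zetaSum h₁ h, if_pos ⟨one_pos, by omega⟩]
      exact hD _ (by omega)
  have coeff_zero_th_mul : ∀ x ∈ Rf n f, c₀ (th n f * x) ∈ D := by
    refine hspan (c₀ ∘ₗ LinearMap.mulLeft ℤ (th n f)) (by simp [h0t]) fun k hk hkn => ?_
    simp only [LinearMap.comp_apply, LinearMap.mulLeft_apply]
    rw [hth, map_sub, hmul, h0t, mul_zero, sub_zero]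
    rcases (show k + 1 ≤ n from hkn).eq_or_lt with h | h
    · rw [h, zetaSum_self, map_neg, hint, h01, mul_one]
      exact neg_mem (hD _ le_rfl)
    · rw [coeff_zetaSum h₀ h, if_neg (by omega)]
      exact zero_mem _
  have hJR (x : Qf n f) (hx : x ∈ J) : x ∈ Rf n f := by
    rw [← hJ, ← one_mul x]
    exact Submodule.mul_mem_mul (Submodule.subset_span (by simp)) hx
  have hJR' (x : Qf n f) (hx : x ∈ J) : th n f * x ∈ Rf n f := by
    rw [← hJ]
    exact Submodule.mul_mem_mul (Submodule.subset_span (by simp)) hx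
  have hle : Submodule.span ℤ {1, th n f} * J ≤ D.comap c₀ := by
    rw [Submodule.mul_le]
    intro a ha x hx
    obtain ⟨r, s, rfl⟩ := Submodule.mem_span_pair.mp ha
    have hx0 : c₀ x ∈ D := by
      have := sub_mem (coeff_one_mem _ (hJR' x hx)) (coeff_one_th_mul x (hJR x hx))
      rwa [sub_sub_cancel] at this
    rw [Submodule.mem_comap, add_mul, smul_mul_assoc, smul_mul_assoc, one_mul, map_add,
      map_smul, map_smul]
    exact add_mem (D.smul_mem r hx0) (D.smul_mem s (coeff_zero_th_mul x (hJR x hx)))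
  have h1 : c₀ 1 ∈ D := hle (hJ ▸ one_mem_Rf f (by omega))
  rw [h01] at h1
  obtain ⟨e, he⟩ := Submodule.mem_span_singleton.mp h1
  rw [zsmul_eq_mul] at he
  exact IsUnit.of_mul_eq_one_right e (by exact_mod_cast he)

variable (n f)

/-- The module `{x ∈ R_f : θ x ∈ R_f}`. -/
def invIf : Submodule ℤ (Qf n f) :=
  Rf n f ⊓ (Rf n f).comap (LinearMap.mulLeft ℤ (th n f))

variable {n f}

lemma mem_invIf {x : Qf n f} : x ∈ invIf n f ↔ x ∈ Rf n f ∧ th n f * x ∈ Rf n f := Iff.rfl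

lemma zetaSum_add_mem_invIf {i : ℕ} (hi : i < n) :
    zetaSum n f i + (f i : Qf n f) ∈ invIf n f := by
  have hn : 0 < n := by omega
  refine mem_invIf.mpr ⟨add_mem (zetaSum_mem_Rf f hn hi.le) (intCast_mem_Rf f hn _), ?_⟩
  rw [← zetaSum_succ]
  exact zetaSum_mem_Rf f hn hi

lemma coe_mem_span_mul_invIf (hn : 0 < n) {i : ℕ} (hi : i ≤ n) :
    (f i : Qf n f) ∈ Submodule.span ℤ {1, th n f} * invIf n f := by
  have h1 {x : Qf n f} (hx : x ∈ invIf n f) :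
      x ∈ Submodule.span ℤ {1, th n f} * invIf n f := by
    rw [← one_mul x]
    exact Submodule.mul_mem_mul (Submodule.subset_span (by simp)) hx
  have hth {j : ℕ} (hj : j < n) :
      zetaSum n f (j + 1) ∈ Submodule.span ℤ {1, th n f} * invIf n f := by
    rw [zetaSum_succ]
    exact Submodule.mul_mem_mul (Submodule.subset_span (by simp)) (zetaSum_add_mem_invIf hj)
  have hz : zetaSum n f i ∈ Submodule.span ℤ {1, th n f} * invIf n f := by
    cases i with
    | zero => simp [zetaSum_zero]
    | succ j => exact hth hi
  rcases hi.eq_or_lt with rfl | hi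
  · rw [zetaSum_self] at hz
    exact neg_mem_iff.mp hz
  · simpa using sub_mem (h1 (zetaSum_add_mem_invIf hi)) hz

lemma one_mem_span_mul_invIf (hn : 0 < n)
    (hgcd : Finset.gcd (Finset.range (n + 1)) f = 1) :
    (1 : Qf n f) ∈ Submodule.span ℤ {1, th n f} * invIf n f := by
  set N := Submodule.span ℤ {1, th n f} * invIf n f with hN
  let K : Ideal ℤ := N.comap (LinearMap.toSpanSingleton ℤ (Qf n f) 1)
  have hK (m : ℤ) : m ∈ K ↔ (m : Qf n f) ∈ N := by simp [K]
  have hg : Submodule.IsPrincipal.generator K ∣ Finset.gcd (Finset.range (n + 1)) f := by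
    refine Finset.dvd_gcd fun i hi => ?_
    rw [← Submodule.IsPrincipal.mem_iff_generator_dvd, hK]
    exact coe_mem_span_mul_invIf hn (by have := Finset.mem_range.mp hi; omega)
  rw [hgcd, ← Submodule.IsPrincipal.mem_iff_generator_dvd, hK] at hg
  simpa using hg

lemma span_mul_invIf_le : Submodule.span ℤ {1, th n f} * invIf n f ≤ Rf n f := by
  rw [Submodule.mul_le]
  intro a ha x hx
  obtain ⟨r, s, rfl⟩ := Submodule.mem_span_pair.mp ha
  rw [mem_invIf] at hx
  rw [add_mul, smul_mul_assoc, smul_mul_assoc, one_mul]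
  exact add_mem ((Rf n f).smul_mem r hx.1) ((Rf n f).smul_mem s hx.2)

end

/-- The fractional ideal `I_f` is invertible (there is an `R_f`-submodule `J` of `Q_f`
with `I_f · J = R_f`) if and only if `gcd(f₀, …, f_n) = 1`, i.e. `f` is primitive. -/
theorem stmt8 (n : ℕ) (hn : 2 ≤ n) (f : ℕ → ℤ) (hf0 : f 0 ≠ 0) :
    (∃ J : Submodule ℤ (Qf n f),
        (∀ r ∈ Rf n f, ∀ x ∈ J, r * x ∈ J) ∧ If n f * J = Rf n f) ↔
      Finset.gcd (Finset.range (n + 1)) f = 1 := by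
  have hn0 : 0 < n := by omega
  constructor
  · rintro ⟨J, hRJ, hJ⟩
    have hRJ' : Rf n f * J = J := by
      refine le_antisymm (Submodule.mul_le.mpr hRJ) fun x hx => ?_
      simpa using Submodule.mul_mem_mul (one_mem_Rf f hn0) hx
    rw [If, mul_comm (Rf n f), mul_assoc, hRJ'] at hJ
    have hu := isUnit_of_span_mul_eq hn hf0
      (fun i hi => Finset.gcd_dvd (Finset.mem_range.mpr (Nat.lt_succ_of_le hi))) hJ
    rw [← Finset.normalize_gcd]
    exact normalize_eq_one.mpr hu
  · intro hgcd
    have hRR := Rf_mul_Rf_le f hn0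
    refine ⟨invIf n f, fun r hr x hx => ?_, ?_⟩
    · rw [mem_invIf] at hx ⊢
      refine ⟨hRR (Submodule.mul_mem_mul hr hx.1), ?_⟩
      rw [mul_left_comm]
      exact hRR (Submodule.mul_mem_mul hr hx.2)
    · rw [If, mul_assoc]
      refine le_antisymm ((mul_le_mul_right span_mul_invIf_le _).trans hRR) fun x hx => ?_
      simpa using Submodule.mul_mem_mul hx (one_mem_span_mul_invIf hn0 hgcd)

end
end
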